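/- For every w ∈ ℝ² with w ≠ (0,0), the ratio μ₂(w,λ) = #{ξ ∈ 𝒪_τ(R_λ(w)) : v(ξ) = λ·𝐰(ξ)} / #𝒪_τ(R_λ(w)) tends to 1 as λ → 0⁺. -/

import Mathlib

open Filter Topology

noncomputable def Fe (lam : ℝ) : Equiv.Perm (ℤ × ℤ) where
  toFun p := (⌊lam * p.1⌋ - p.2, p.1)
  invFun p := (p.2, ⌊lam * p.2⌋ - p.1)
  left_inv p := by simp
  right_inv p := by simp

noncomputable def pt (lam : ℝ) (p : ℤ × ℤ) : ℝ × ℝ := (lam * p.1, lam * p.2)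

noncomputable def wfield (q : ℝ × ℝ) : ℤ × ℤ := (2*⌊q.2⌋+1, -(2*⌊q.1⌋+1))

def vcond (lam : ℝ) (p : ℤ × ℤ) : Prop :=
  pt lam ((Fe lam ^ 4) p) - pt lam p
    = lam • ((((wfield (pt lam p)).1 : ℝ)), (((wfield (pt lam p)).2 : ℝ)))

/-- Euclidean distance from `z ∈ ℝ²` to the symmetry line `{(t,t)}`. -/
noncomputable def dline (z : ℝ × ℝ) : ℝ := |z.1 - z.2| / Real.sqrt 2

/-- The return domain `X`, described by lattice indices. -/
noncomputable def Xset (lam : ℝ) : Set (ℤ × ℤ) :=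
  {p | 0 ≤ p.1 ∧ 0 ≤ p.2 ∧
    dline (pt lam p) ≤ dline (pt lam ((Fe lam ^ 4) p)) ∧
    dline (pt lam p) < dline (pt lam ((Fe lam ^ (-4 : ℤ)) p))}

/-- The forward transit time `τ(z) = min{k ≥ 1 : F_λᵏ(z) ∈ X}`. -/
noncomputable def tauPlus (lam : ℝ) (p : ℤ × ℤ) : ℕ :=
  sInf {k : ℕ | 1 ≤ k ∧ (Fe lam ^ (k : ℤ)) p ∈ Xset lam}

/-- The backward transit time `τ₋(z) = min{k ≥ 0 : F_λ⁻ᵏ(z) ∈ X}`. -/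
noncomputable def tauMinus (lam : ℝ) (p : ℤ × ℤ) : ℕ :=
  sInf {k : ℕ | (Fe lam ^ (-(k : ℤ))) p ∈ Xset lam}

/-- The return orbit `𝒪_τ(z) = {F_λᵏ(z) : −τ₋(z) ≤ k ≤ τ(z)}` (lattice indices). -/
noncomputable def retOrbit (lam : ℝ) (p : ℤ × ℤ) : Set (ℤ × ℤ) :=
  {q | ∃ k : ℤ, -(tauMinus lam p : ℤ) ≤ k ∧ k ≤ (tauPlus lam p : ℤ) ∧ q = (Fe lam ^ k) p}

/-- The rescaled round-off `R_λ(w) = λ(⌊w₁/λ⌋, ⌊w₂/λ⌋)`, as a lattice index. -/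
noncomputable def Rlam (lam : ℝ) (w : ℝ × ℝ) : ℤ × ℤ := (⌊w.1 / lam⌋, ⌊w.2 / lam⌋)

noncomputable def mu2 (w : ℝ × ℝ) (lam : ℝ) : ℝ :=
  ({q | q ∈ retOrbit lam (Rlam lam w) ∧ vcond lam q} : Set (ℤ × ℤ)).ncard /
    (retOrbit lam (Rlam lam w)).ncard


/-! ### Basic facts -/

lemma floor_neg_of {lam : ℝ} (hl : 0 < lam) {x : ℤ} (hx : x < 0) : ⌊lam * (x : ℝ)⌋ ≤ -1 := by
  have : ⌊lam * (x : ℝ)⌋ < 0 := by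
    rw [Int.floor_lt]
    have : (x : ℝ) < 0 := by exact_mod_cast hx
    push_cast
    nlinarith
  omega

lemma floor_nonneg_of {lam : ℝ} (hl : 0 < lam) {x : ℤ} (hx : 0 ≤ x) : 0 ≤ ⌊lam * (x : ℝ)⌋ := by
  rw [Int.floor_nonneg]
  have : (0 : ℝ) ≤ x := by exact_mod_cast hx
  positivity

lemma floor_mono_of {lam : ℝ} (hl : 0 < lam) {x y : ℤ} (h : x ≤ y) :
    ⌊lam * (x : ℝ)⌋ ≤ ⌊lam * (y : ℝ)⌋ := by
  apply Int.floor_le_floor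
  have : (x : ℝ) ≤ y := by exact_mod_cast h
  nlinarith

lemma floor_bd {t : ℝ} {M : ℤ} (h : |t| ≤ M) : -M ≤ ⌊t⌋ ∧ ⌊t⌋ ≤ M := by
  rw [abs_le] at h
  constructor
  · rw [Int.le_floor]; push_cast; linarith
  · have : ⌊t⌋ < M + 1 := by
      rw [Int.floor_lt]; push_cast; linarith
    omega

/-- Boundedness of the rescaled point. -/
def Bd (lam : ℝ) (M : ℤ) (p : ℤ × ℤ) : Prop := |lam * (p.1 : ℝ)| ≤ M ∧ |lam * (p.2 : ℝ)| ≤ M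

lemma Fe_apply (lam : ℝ) (p : ℤ × ℤ) : Fe lam p = (⌊lam * (p.1 : ℝ)⌋ - p.2, p.1) := rfl

lemma Fe_inv (lam : ℝ) (p : ℤ × ℤ) : (Fe lam)⁻¹ p = (Fe lam p.swap).swap := rfl

lemma Fe_pow_succ (lam : ℝ) (k : ℕ) (p : ℤ × ℤ) :
    (Fe lam ^ (k + 1)) p = Fe lam ((Fe lam ^ k) p) := by
  rw [pow_succ']; rfl

lemma Fe_pow_add (lam : ℝ) (k l : ℕ) (p : ℤ × ℤ) :
    (Fe lam ^ (k + l)) p = (Fe lam ^ k) ((Fe lam ^ l) p) := by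
  rw [pow_add]; rfl

lemma Fe_inv_pow (lam : ℝ) (k : ℕ) (p : ℤ × ℤ) :
    ((Fe lam)⁻¹ ^ k) p = ((Fe lam ^ k) p.swap).swap := by
  induction k with
  | zero => simp
  | succ k ih =>
    rw [pow_succ', pow_succ', Equiv.Perm.mul_apply, ih, Fe_inv, Equiv.Perm.mul_apply, Prod.swap_swap]

lemma Fe_neg (lam : ℝ) (k : ℕ) (p : ℤ × ℤ) :
    (Fe lam ^ (-(k : ℤ))) p = ((Fe lam ^ k) p.swap).swap := by
  rw [zpow_neg, ← inv_zpow, zpow_natCast, Fe_inv_pow]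

lemma Fe_neg4 (lam : ℝ) (p : ℤ × ℤ) :
    (Fe lam ^ (-4 : ℤ)) p = ((Fe lam ^ 4) p.swap).swap := Fe_neg lam 4 p

lemma Fe4 (lam : ℝ) (p : ℤ × ℤ) : (Fe lam ^ 4) p = Fe lam (Fe lam (Fe lam (Fe lam p))) := rfl

lemma F4_form (lam : ℝ) (x y : ℤ) : ∃ a b c d : ℤ,
    a = ⌊lam * ((x : ℤ) : ℝ)⌋ ∧ b = ⌊lam * ((a - y : ℤ) : ℝ)⌋ ∧ c = ⌊lam * ((b - x : ℤ) : ℝ)⌋ ∧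
    d = ⌊lam * ((c - a + y : ℤ) : ℝ)⌋ ∧
    Fe lam (x, y) = (a - y, x) ∧ (Fe lam ^ 2) (x, y) = (b - x, a - y) ∧
    (Fe lam ^ 3) (x, y) = (c - a + y, b - x) ∧
    (Fe lam ^ 4) (x, y) = (d - b + x, c - a + y) := by
  refine ⟨_, _, _, _, rfl, rfl, rfl, rfl, rfl, rfl, ?_, ?_⟩
  · show Fe lam (Fe lam (Fe lam (x, y))) = _
    simp only [Fe_apply]
    ext <;> simp
    ring
  · rw [Fe4]
    simp only [Fe_apply]
    have h : ∀ u v w : ℤ, u - (v - w) = u - v + w := by intros; ring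
    simp only [h]

lemma bd_mul {lam : ℝ} (hl : 0 < lam) {M : ℤ} {x e E : ℤ} (hx : |lam * (x : ℝ)| ≤ M)
    (he : |e| ≤ E) (hE : lam * E ≤ 1) : |lam * ((e + x : ℤ) : ℝ)| ≤ ((M + 1 : ℤ) : ℝ) := by
  have h1 : |(e : ℝ)| ≤ E := by exact_mod_cast he
  rw [abs_le] at *
  push_cast
  constructor <;> nlinarith

/-- One `F⁴` step: the four floors, with bounds. -/
lemma F4_bd {lam : ℝ} (hl : 0 < lam) {M : ℤ} (hM : lam * (8 * M + 20) ≤ 1) {x y : ℤ}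
    (hb : Bd lam M (x, y)) (hM0 : 0 ≤ M) : ∃ a b c d : ℤ,
    a = ⌊lam * ((x : ℤ) : ℝ)⌋ ∧ b = ⌊lam * ((a - y : ℤ) : ℝ)⌋ ∧ c = ⌊lam * ((b - x : ℤ) : ℝ)⌋ ∧
    d = ⌊lam * ((c - a + y : ℤ) : ℝ)⌋ ∧
    Fe lam (x, y) = (a - y, x) ∧ (Fe lam ^ 2) (x, y) = (b - x, a - y) ∧
    (Fe lam ^ 3) (x, y) = (c - a + y, b - x) ∧
    (Fe lam ^ 4) (x, y) = (d - b + x, c - a + y) ∧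
    (-M ≤ a ∧ a ≤ M) ∧ (-(M+1) ≤ b ∧ b ≤ M + 1) ∧ (-(M+1) ≤ c ∧ c ≤ M + 1) ∧
    (-(M+1) ≤ d ∧ d ≤ M + 1) := by
  obtain ⟨a, b, c, d, ha, hb', hc, hd, h1, h2, h3, h4⟩ := F4_form lam x y
  obtain ⟨hx, hy⟩ := hb
  simp only at hx hy
  have hM' : (0 : ℝ) ≤ M := by exact_mod_cast hM0
  have hx' : |lam * ((-x : ℤ) : ℝ)| ≤ M := by push_cast; rw [mul_neg, abs_neg]; exact hx
  have hy' : |lam * ((-y : ℤ) : ℝ)| ≤ M := by push_cast; rw [mul_neg, abs_neg]; exact hy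
  have Ba := floor_bd hx
  rw [← ha] at Ba
  have e1 : lam * ((2 * M + 1 : ℤ) : ℝ) ≤ 1 := by push_cast; nlinarith
  have Bb := floor_bd (bd_mul hl hy' (e := a) (E := 2 * M + 1) (by rw [abs_le]; omega) e1)
  rw [← sub_eq_add_neg, ← hb'] at Bb
  have Bc := floor_bd (bd_mul hl hx' (e := b) (E := 2 * M + 1) (by rw [abs_le]; omega) e1)
  rw [← sub_eq_add_neg, ← hc] at Bc
  have Bd' := floor_bd (bd_mul hl hy (e := c - a) (E := 2 * M + 1) (by rw [abs_le]; omega) e1)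
  rw [← hd] at Bd'
  exact ⟨a, b, c, d, ha, hb', hc, hd, h1, h2, h3, h4, Ba, by omega, by omega, by omega⟩

/-- The step lemma in the upper half plane. -/
lemma step_top {lam : ℝ} (hl : 0 < lam) {M : ℤ} (hM : lam * (8 * M + 20) ≤ 1) {p : ℤ × ℤ}
    (hb : Bd lam M p) (hM0 : 0 ≤ M) (hy : 2 * M + 2 ≤ p.2) :
    p.1 + 1 ≤ ((Fe lam ^ 4) p).1 ∧ (0 ≤ p.1 → ((Fe lam ^ 4) p).2 ≤ p.2 - 1) ∧
    (p.1 < 0 → p.2 ≤ ((Fe lam ^ 4) p).2) ∧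
    (p.1 ≤ -(M + 1) → p.2 + 1 ≤ ((Fe lam ^ 4) p).2) ∧
    (p.1 < 0 → -p.1 ≤ p.2 → ((Fe lam ^ 4) p).2 - p.2 ≤ ((Fe lam ^ 4) p).1 - p.1) ∧
    (0 ≤ p.1 → lam * (p.1 : ℝ) < 1 / 2 → p.2 - 1 ≤ ((Fe lam ^ 4) p).2) := by
  obtain ⟨x, y⟩ := p
  obtain ⟨a, b, c, d, ha, hb', hc, hd, h1, h2, h3, h4, Ba, Bb, Bc, Bdd⟩ := F4_bd hl hM hb hM0
  rw [h4]
  simp only at *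
  have hM' : (0 : ℝ) ≤ M := by exact_mod_cast hM0
  have b1 : b ≤ -1 := by rw [hb']; exact floor_neg_of hl (by omega)
  have d0 : 0 ≤ d := by rw [hd]; exact floor_nonneg_of hl (by omega)
  have apos : 0 ≤ x → 0 ≤ a := fun h => by rw [ha]; exact floor_nonneg_of hl h
  have aneg : x < 0 → a ≤ -1 := fun h => by rw [ha]; exact floor_neg_of hl h
  have cneg : 0 ≤ x → c ≤ -1 := fun h => by rw [hc]; exact floor_neg_of hl (by omega)
  have cge : x < 0 → -1 ≤ c := fun h => by
    rw [hc, Int.le_floor]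
    have h1 : (-(M + 1) : ℝ) ≤ b := by exact_mod_cast Bb.1
    have h2 : (x : ℝ) ≤ -1 := by exact_mod_cast (by omega : x ≤ -1)
    push_cast
    nlinarith
  refine ⟨by omega, fun h => ?_, fun h => ?_, fun h => ?_, fun h h' => ?_, fun h h' => ?_⟩
  · have := apos h; have := cneg h; omega
  · have := aneg h; have := cge h; omega
  · have := aneg (by omega)
    have : 0 ≤ c := by rw [hc]; exact floor_nonneg_of hl (by omega)
    omega
  · have h5 := aneg h
    have h6 := cge h
    have hdf : ⌊lam * (y : ℝ)⌋ ≤ d := by rw [hd]; exact floor_mono_of hl (by omega)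
    have hcf : c ≤ ⌊lam * (y : ℝ)⌋ := by rw [hc]; exact floor_mono_of hl (by omega)
    have hfl := Int.floor_le (lam * (y : ℝ))
    have hfu := Int.lt_floor_add_one (lam * (y : ℝ))
    have hbf : b < -⌊lam * (y : ℝ)⌋ := by
      rw [hb', Int.floor_lt]
      have : (a : ℝ) ≤ -1 := by exact_mod_cast h5
      push_cast
      nlinarith
    have haf : -⌊lam * (y : ℝ)⌋ - 1 ≤ a := by
      rw [ha, Int.le_floor]
      have : (-x : ℝ) ≤ y := by exact_mod_cast h'
      push_cast
      nlinarith
    omega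
  · have a0 : a ≤ 0 := by
      have : a < 1 := by
        rw [ha, Int.floor_lt]; push_cast; linarith
      omega
    have : -1 ≤ c := by
      rw [hc, Int.le_floor]
      have h1 : (-(M + 1) : ℝ) ≤ b := by exact_mod_cast Bb.1
      push_cast
      nlinarith
    omega

lemma step_small {lam : ℝ} (hl : 0 < lam) {M : ℤ} (hM : lam * (8 * M + 20) ≤ 1) {p : ℤ × ℤ}
    (hb : Bd lam M p) (hM0 : 0 ≤ M) :
    |((Fe lam ^ 4) p).1 - p.1| ≤ 2 * M + 2 ∧ |((Fe lam ^ 4) p).2 - p.2| ≤ 2 * M + 2 := by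
  obtain ⟨x, y⟩ := p
  obtain ⟨a, b, c, d, ha, hb', hc, hd, h1, h2, h3, h4, Ba, Bb, Bc, Bdd⟩ := F4_bd hl hM hb hM0
  rw [h4]
  simp only [abs_le]
  omega

/-- Signed lattice distance to the diagonal. -/
def sd (p : ℤ × ℤ) : ℤ := p.1 - p.2

lemma sd_swap (p : ℤ × ℤ) : sd p.swap = - sd p := by simp [sd]

lemma dline_pt {lam : ℝ} (hl : 0 < lam) (p : ℤ × ℤ) :
    dline (pt lam p) = lam / Real.sqrt 2 * ((|sd p| : ℤ) : ℝ) := by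
  simp only [dline, pt, sd]
  rw [← mul_sub, abs_mul, abs_of_pos hl]
  push_cast
  ring

lemma mem_X {lam : ℝ} (hl : 0 < lam) (p : ℤ × ℤ) : p ∈ Xset lam ↔
    0 ≤ p.1 ∧ 0 ≤ p.2 ∧ |sd p| ≤ |sd ((Fe lam ^ 4) p)| ∧
      |sd p| < |sd ((Fe lam ^ (-4 : ℤ)) p)| := by
  have h : 0 < lam / Real.sqrt 2 := by positivity
  simp only [Xset, Set.mem_ofPred_eq, dline_pt hl]
  rw [mul_le_mul_iff_right₀ h, mul_lt_mul_iff_right₀ h, Int.cast_le, Int.cast_lt]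

lemma mem_X_swap {lam : ℝ} (hl : 0 < lam) (p : ℤ × ℤ) : p.swap ∈ Xset lam ↔
    0 ≤ p.1 ∧ 0 ≤ p.2 ∧ |sd p| ≤ |sd ((Fe lam ^ (-4 : ℤ)) p)| ∧
      |sd p| < |sd ((Fe lam ^ 4) p)| := by
  rw [mem_X hl, Fe_neg4, Fe_neg4, Prod.swap_swap, sd_swap, sd_swap, sd_swap]
  simp only [abs_neg, Prod.fst_swap, Prod.snd_swap]
  tauto

lemma Bd_swap {lam : ℝ} {M : ℤ} {p : ℤ × ℤ} (h : Bd lam M p) : Bd lam M p.swap := ⟨h.2, h.1⟩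

lemma sd_fwd {lam : ℝ} (hl : 0 < lam) {M : ℤ} (hM : lam * (8 * M + 20) ≤ 1) {p : ℤ × ℤ}
    (hb : Bd lam M p) (hM0 : 0 ≤ M) (hy : 2 * M + 2 ≤ p.2) (hx : 0 ≤ p.1) :
    sd p < sd ((Fe lam ^ 4) p) ∧ sd ((Fe lam ^ 4) p) ≤ sd p + (4 * M + 4) := by
  obtain ⟨h1, h2, -⟩ := step_top hl hM hb hM0 hy
  have h3 := step_small hl hM hb hM0
  have h2 := h2 hx
  simp only [abs_le, sd] at *
  omega

lemma sd_bwd {lam : ℝ} (hl : 0 < lam) {M : ℤ} (hM : lam * (8 * M + 20) ≤ 1) {p : ℤ × ℤ}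
    (hb : Bd lam M p) (hM0 : 0 ≤ M) (hy : 0 ≤ p.2) (hx : 2 * M + 2 ≤ p.1) :
    sd ((Fe lam ^ (-4 : ℤ)) p) < sd p ∧ sd p ≤ sd ((Fe lam ^ (-4 : ℤ)) p) + (4 * M + 4) := by
  have := sd_fwd hl hM (Bd_swap hb) hM0 hx hy
  rw [Fe_neg4, sd_swap]
  rw [sd_swap] at this
  omega

/-- At a crossing of the diagonal there is a point of `X`, and a point of its mirror image. -/
lemma cross {lam : ℝ} (hl : 0 < lam) {M : ℤ} (hM : lam * (8 * M + 20) ≤ 1) {p : ℤ × ℤ}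
    (hM0 : 0 ≤ M) (hb : Bd lam M p) (hb' : Bd lam M ((Fe lam ^ 4) p))
    (hx : 6 * M + 6 ≤ p.1) (hy : 6 * M + 6 ≤ p.2) (hs : sd p < 0) (hs' : 0 ≤ sd ((Fe lam ^ 4) p)) :
    (p ∈ Xset lam ∨ (Fe lam ^ 4) p ∈ Xset lam) ∧
    (p.swap ∈ Xset lam ∨ ((Fe lam ^ 4) p).swap ∈ Xset lam) := by
  rw [mem_X hl, mem_X hl, mem_X_swap hl, mem_X_swap hl]
  have h0 := step_small hl hM hb hM0
  have h1 := sd_bwd hl hM hb hM0 (by omega) (by omega)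
  have e : (Fe lam ^ (-4 : ℤ)) ((Fe lam ^ 4) p) = p := by
    rw [zpow_neg]; exact (Fe lam ^ 4).symm_apply_apply p
  rw [e]
  simp only [abs_le] at h0
  have h2 := sd_fwd hl hM hb' hM0 (by omega) (by omega)
  set s := sd p
  set t := sd ((Fe lam ^ 4) p)
  set u := sd ((Fe lam ^ 4) ((Fe lam ^ 4) p))
  set v := sd ((Fe lam ^ (-4 : ℤ)) p)
  rw [abs_of_neg hs, abs_of_nonneg hs', abs_of_neg (by omega : v < 0), abs_of_pos (by omega : 0 < u)]
  omega

/-- No early return to `X`. -/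
lemma no_return {lam : ℝ} (hl : 0 < lam) {M : ℤ} (hM : lam * (8 * M + 20) ≤ 1) {p : ℤ × ℤ}
    (hM0 : 0 ≤ M) (hb : Bd lam (M - 1) p) {L : ℤ} (hL : 20 * M + 20 ≤ L)
    (hn : 2 * L ≤ |p.1| ∨ 2 * L ≤ |p.2|) (hp : p ∈ Xset lam) {T : ℤ}
    (hT : 2 * (T * (2 * M + 2)) ≤ L) (hT' : lam * (T * (2 * M + 2) : ℤ) ≤ 1) (k : ℕ) (hk1 : 1 ≤ k) (hkT : (k : ℤ) ≤ 4 * T) :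
    (Fe lam ^ k) p ∉ Xset lam := by
  have hbM : Bd lam M p := by
    obtain ⟨h1, h2⟩ := hb; push_cast at h1 h2; exact ⟨by linarith, by linarith⟩
  obtain ⟨hx0, hy0, hf, hg⟩ := (mem_X hl p).1 hp
  rw [abs_of_nonneg hx0, abs_of_nonneg hy0] at hn
  -- both coordinates are large
  have hx : L ≤ p.1 := by
    by_contra hcon
    have h := sd_fwd hl hM hbM hM0 (by omega) (by omega)
    have : sd p = p.1 - p.2 := rfl
    rw [abs_of_neg (by omega), abs_of_neg (by omega)] at hf
    omega
  have hy : L ≤ p.2 := by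
    by_contra hcon
    have h := sd_bwd hl hM hbM hM0 (by omega) (by omega)
    have : sd p = p.1 - p.2 := rfl
    rw [abs_of_pos (by omega), abs_of_pos (by omega)] at hg
    omega
  have key : ∀ j : ℕ, (j : ℤ) ≤ T → |((Fe lam ^ (4 * j)) p).1 - p.1| ≤ j * (2 * M + 2) ∧
      |((Fe lam ^ (4 * j)) p).2 - p.2| ≤ j * (2 * M + 2) ∧ Bd lam M ((Fe lam ^ (4 * j)) p) ∧
      10 * M + 10 ≤ ((Fe lam ^ (4 * j)) p).1 ∧ 10 * M + 10 ≤ ((Fe lam ^ (4 * j)) p).2 := by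
    intro j
    induction j with
    | zero => intro _; simp; exact ⟨hbM, by omega, by omega⟩
    | succ j ih =>
      intro hj
      push_cast at hj
      obtain ⟨i1, i2, i3, i4, i5⟩ := ih (by omega)
      have e : (Fe lam ^ (4 * (j + 1))) p = (Fe lam ^ 4) ((Fe lam ^ (4 * j)) p) := by
        rw [← Fe_pow_add]; congr 2; ring
      rw [e]
      obtain ⟨s1, s2⟩ := step_small hl hM i3 hM0
      have hjT : ((j : ℤ) + 1) * (2 * M + 2) ≤ T * (2 * M + 2) := by nlinarith
      set q := (Fe lam ^ (4 * j)) p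
      set q' := (Fe lam ^ 4) q
      have d1 : |q'.1 - p.1| ≤ ((j : ℤ) + 1) * (2 * M + 2) := by
        calc |q'.1 - p.1| = |(q'.1 - q.1) + (q.1 - p.1)| := by congr 1; ring
          _ ≤ _ := abs_add_le _ _
          _ ≤ _ := by linarith
      have d2 : |q'.2 - p.2| ≤ ((j : ℤ) + 1) * (2 * M + 2) := by
        calc |q'.2 - p.2| = |(q'.2 - q.2) + (q.2 - p.2)| := by congr 1; ring
          _ ≤ _ := abs_add_le _ _
          _ ≤ _ := by linarith
      refine ⟨by push_cast; exact d1, by push_cast; exact d2, ⟨?_, ?_⟩, ?_, ?_⟩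
      · have := bd_mul hl hb.1 (d1.trans hjT) hT'
        simpa using this
      · have := bd_mul hl hb.2 (d2.trans hjT) hT'
        simpa using this
      · have := (abs_le.1 d1).1; omega
      · have := (abs_le.1 d2).1; omega
  have mono : ∀ j : ℕ, (j : ℤ) ≤ T → sd ((Fe lam ^ (4 * j)) p) < sd ((Fe lam ^ (4 * (j + 1))) p) := by
    intro j hj
    have e : (Fe lam ^ (4 * (j + 1))) p = (Fe lam ^ 4) ((Fe lam ^ (4 * j)) p) := by
      rw [← Fe_pow_add]; congr 2; ring
    rw [e]
    obtain ⟨i1, i2, i3, i4, i5⟩ := key j hj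
    exact (sd_fwd hl hM i3 hM0 (by omega) (by omega)).1
  obtain ⟨j, l, hl4, rfl⟩ : ∃ j l : ℕ, l < 4 ∧ k = l + 4 * j := ⟨k / 4, k % 4, by omega, by omega⟩
  push_cast at hkT
  obtain ⟨i1, i2, i3, i4, i5⟩ := key j (by omega)
  have hadd := Fe_pow_add lam l (4 * j) p
  set q := (Fe lam ^ (4 * j)) p with hq
  obtain ⟨a, b, c, d, ha, hb', hc, hd, h1, h2, h3, h4, Ba, Bb, Bc, Bdd⟩ :=
    F4_bd hl hM (x := q.1) (y := q.2) i3 hM0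
  interval_cases l
  · -- `k` divisible by four
    rw [hadd, pow_zero]
    simp only [Equiv.Perm.coe_one, id_eq]
    intro hX
    obtain ⟨_, _, _, hX⟩ := (mem_X hl q).1 hX
    obtain ⟨i, rfl⟩ : ∃ i, j = i + 1 := ⟨j - 1, by omega⟩
    have e : (Fe lam ^ (-4 : ℤ)) q = (Fe lam ^ (4 * i)) p := by
      have : q = (Fe lam ^ 4) ((Fe lam ^ (4 * i)) p) := by
        rw [hq, ← Fe_pow_add]; congr 2; ring
      rw [this, zpow_neg]
      exact (Fe lam ^ 4).symm_apply_apply _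
    rw [e] at hX
    push_cast at hkT
    have m1 := mono i (by omega)
    rw [← hq] at m1
    have hneg : sd q + sd ((Fe lam ^ (4 * i)) p) < 0 := by
      rw [abs_lt] at hX
      rcases abs_cases (sd ((Fe lam ^ (4 * i)) p)) with h | h <;> omega
    have m0 := mono 0 (by omega)
    simp only [mul_zero, pow_zero, Equiv.Perm.coe_one, id_eq, zero_add, mul_one] at m0
    have hpos : 0 ≤ sd p + sd ((Fe lam ^ 4) p) := by
      rcases abs_cases (sd p) with h | h <;> rcases abs_cases (sd ((Fe lam ^ 4) p)) with h' | h' <;> omega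
    have hmon : ∀ n : ℕ, n ≤ i → sd p ≤ sd ((Fe lam ^ (4 * n)) p) := by
      intro n
      induction n with
      | zero => intro _; simp
      | succ n ih =>
        intro hn
        exact (ih (by omega)).trans (mono n (by omega)).le
    have hmon' : ∀ n : ℕ, n ≤ i → sd ((Fe lam ^ 4) p) ≤ sd ((Fe lam ^ (4 * (n + 1))) p) := by
      intro n
      induction n with
      | zero => intro _; simp
      | succ n ih =>
        intro hn
        exact (ih (by omega)).trans (mono (n + 1) (by push_cast; omega)).le
    have a1 := hmon i le_rfl
    have a2 := hmon' i le_rfl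
    rw [← hq] at a2
    omega
  · rw [hadd]
    intro hX
    have := hX.1
    rw [pow_one, h1] at this
    simp only at this
    omega
  · rw [hadd]
    intro hX
    have := hX.1
    rw [h2] at this
    simp only at this
    omega
  · rw [hadd]
    intro hX
    have := hX.2.1
    rw [h3] at this
    simp only at this
    omega

/-! ### Closeness to the grid lines -/

def NearC (lam : ℝ) (D : ℕ) (x : ℤ) : Prop := ∃ n : ℤ, |lam * (x : ℝ) - n| ≤ lam * D

def Near (lam : ℝ) (D : ℕ) (p : ℤ × ℤ) : Prop := NearC lam D p.1 ∨ NearC lam D p.2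

lemma NearC_neg {lam : ℝ} {D : ℕ} {x : ℤ} (h : NearC lam D (-x)) : NearC lam D x := by
  obtain ⟨n, hn⟩ := h
  refine ⟨-n, ?_⟩
  rw [← abs_neg]
  push_cast at hn ⊢
  convert hn using 2
  ring

lemma NearC_add {lam : ℝ} (hl : 0 < lam) {D E : ℕ} {x e : ℤ} (h : NearC lam D (e + x))
    (he : |e| ≤ E) : NearC lam (D + E) x := by
  obtain ⟨n, hn⟩ := h
  refine ⟨n, ?_⟩
  have h1 : |(e : ℝ)| ≤ E := by exact_mod_cast he
  rw [abs_le] at *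
  push_cast at *
  constructor <;> nlinarith

lemma NearC_mono {lam : ℝ} (hl : 0 < lam) {D E : ℕ} {x : ℤ} (h : NearC lam D x)
    (hDE : D ≤ E) : NearC lam E x := by
  obtain ⟨n, hn⟩ := h
  refine ⟨n, hn.trans ?_⟩
  have : (D : ℝ) ≤ E := by exact_mod_cast hDE
  nlinarith

lemma not_near {lam : ℝ} (hl : 0 < lam) {D : ℕ} {x e : ℤ} (h : ¬ NearC lam D x) (he : |e| ≤ D) :
    ⌊lam * ((e + x : ℤ) : ℝ)⌋ = ⌊lam * (x : ℝ)⌋ ∧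
    ⌊lam * ((e - x : ℤ) : ℝ)⌋ = -⌊lam * (x : ℝ)⌋ - 1 := by
  have h1 : |(e : ℝ)| ≤ D := by exact_mod_cast he
  rw [abs_le] at h1
  have hfl := Int.floor_le (lam * (x : ℝ))
  have hfu := Int.lt_floor_add_one (lam * (x : ℝ))
  simp only [NearC, not_exists, not_le] at h
  have ha := h ⌊lam * (x : ℝ)⌋
  have hb := h (⌊lam * (x : ℝ)⌋ + 1)
  rw [abs_of_nonneg (by linarith)] at ha
  push_cast at hb
  rw [abs_of_neg (by linarith)] at hb
  constructor
  · rw [Int.floor_eq_iff]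
    push_cast
    constructor <;> nlinarith
  · rw [Int.floor_eq_iff]
    push_cast
    constructor <;> nlinarith

lemma near_of_not_vcond {lam : ℝ} (hl : 0 < lam) {M D : ℕ} (hM : lam * (8 * M + 20) ≤ 1)
    (hD : 2 * M + 2 ≤ D) {p : ℤ × ℤ} (hb : Bd lam M p) (h : ¬ vcond lam p) : Near lam D p := by
  by_contra hn
  apply h
  obtain ⟨x, y⟩ := p
  simp only [Near, not_or] at hn
  obtain ⟨hnx, hny⟩ := hn
  obtain ⟨a, b, c, d, ha, hb', hc, hd, h1, h2, h3, h4, Ba, Bb, Bc, Bdd⟩ :=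
    F4_bd hl (M := M) (by exact_mod_cast hM) hb (by omega)
  have eb := (not_near hl hny (e := a) (by rw [abs_le]; omega)).2
  have ec := (not_near hl hnx (e := b) (by rw [abs_le]; omega)).2
  have ed := (not_near hl hny (e := c - a) (by rw [abs_le]; omega)).1
  rw [← hb'] at eb
  rw [← hc] at ec
  rw [← hd] at ed
  simp only [vcond, h4, pt, wfield]
  rw [← ha] at ec
  rw [← ha, ← ed]
  have eb' : b = -d - 1 := by rw [eb, ed]
  rw [eb', ec]
  ext
  · simp; ring
  · simp; ring

lemma near_finset {lam : ℝ} (hl : 0 < lam) (M D : ℕ) (hD : lam * D ≤ 1) :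
    ∃ T : Finset ℤ, T.card ≤ (2 * M + 3) * (2 * D + 1) ∧
      ∀ x : ℤ, |lam * (x : ℝ)| ≤ M → NearC lam D x → x ∈ T := by
  refine ⟨(Finset.Icc (-(M + 1 : ℤ)) (M + 1)).biUnion
    (fun n => Finset.Icc ⌈(n : ℝ) / lam - D⌉ ⌊(n : ℝ) / lam + D⌋), ?_, ?_⟩
  · refine (Finset.card_biUnion_le_card_mul _ _ (2 * D + 1) ?_).trans ?_
    · intro n _
      rw [Int.card_Icc]
      have h1 := Int.floor_le ((n : ℝ) / lam + D)
      have h2 := Int.le_ceil ((n : ℝ) / lam - D)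
      have : ((⌊(n : ℝ) / lam + D⌋ - ⌈(n : ℝ) / lam - D⌉ : ℤ) : ℝ) ≤ ((2 * D : ℤ) : ℝ) := by
        push_cast; linarith
      have := Int.cast_le.1 this
      omega
    · rw [Int.card_Icc]
      apply Nat.mul_le_mul_right
      omega
  · rintro x hx ⟨n, hn⟩
    rw [Finset.mem_biUnion]
    rw [abs_le] at hx hn
    refine ⟨n, ?_, ?_⟩
    · rw [Finset.mem_Icc]
      have h1 : (n : ℝ) ≤ ((M + 1 : ℤ) : ℝ) := by push_cast; linarith
      have h2 : ((-(M + 1 : ℤ) : ℤ) : ℝ) ≤ n := by push_cast; linarith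
      exact ⟨Int.cast_le.1 h2, Int.cast_le.1 h1⟩
    · rw [Finset.mem_Icc, Int.ceil_le, Int.le_floor]
      constructor
      · rw [sub_le_iff_le_add, div_le_iff₀ hl]; nlinarith
      · rw [← sub_le_iff_le_add, le_div_iff₀ hl]; nlinarith

/-! ### The invariant region -/

def InvR (lam r : ℝ) (B : ℕ) (p : ℤ × ℤ) : Prop :=
  (p.1 < 0 ∧ -p.1 ≤ p.2 ∧ r ≤ lam * (p.2 : ℝ) ∧ lam * ((p.2 : ℝ) - p.1) ≤ B) ∨
  (0 ≤ p.1 ∧ p.1 < p.2 ∧ lam * (p.2 : ℝ) ≤ B + 1 ∧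
    (r ≤ lam * ((p.1 : ℝ) + p.2) ∨ r / 2 ≤ lam * (p.1 : ℝ)))

lemma Inv_facts {lam r : ℝ} {B : ℕ} {p : ℤ × ℤ} (hl : 0 < lam) (hr : 0 < r) (h : InvR lam r B p) :
    Bd lam (B + 1 : ℕ) p ∧ r / 2 ≤ lam * (p.2 : ℝ) ∧ sd p < 0 := by
  have hB : (0 : ℝ) ≤ B := by positivity
  rcases h with ⟨h1, h2, h3, h4⟩ | ⟨h1, h2, h3, h4⟩
  · have h1' : (p.1 : ℝ) < 0 := by exact_mod_cast h1
    have h2' : (-p.1 : ℝ) ≤ p.2 := by exact_mod_cast h2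
    refine ⟨⟨?_, ?_⟩, by linarith, by simp only [sd]; omega⟩ <;> (push_cast; rw [abs_le]; constructor <;> nlinarith)
  · have h1' : (0 : ℝ) ≤ p.1 := by exact_mod_cast h1
    have h2' : (p.1 : ℝ) < p.2 := by exact_mod_cast h2
    refine ⟨⟨?_, ?_⟩, ?_, by simp only [sd]; omega⟩
    · push_cast; rw [abs_le]; constructor <;> nlinarith
    · push_cast; rw [abs_le]; constructor <;> nlinarith
    · rcases h4 with h4 | h4 <;> nlinarith

lemma large_of {lam r : ℝ} (hl : 0 < lam) {N y : ℤ} (hN : lam * N ≤ r) (hy : r ≤ lam * (y : ℝ)) :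
    N ≤ y := by
  have : (N : ℝ) ≤ y := by
    have := hN.trans hy
    exact le_of_mul_le_mul_left this hl
  exact_mod_cast this

lemma Inv_step {lam r : ℝ} {B : ℕ} {p : ℤ × ℤ} (hl : 0 < lam) (hr : 0 < r) (hr1 : r ≤ 1)
    (hlam : lam * (200 * B + 400) ≤ r) (h : InvR lam r B p) :
    p.1 + 1 ≤ ((Fe lam ^ 4) p).1 ∧
    (InvR lam r B ((Fe lam ^ 4) p) ∨ 0 ≤ sd ((Fe lam ^ 4) p)) := by
  obtain ⟨hb, hy, hs⟩ := Inv_facts hl hr h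
  have hB : (0 : ℝ) ≤ B := by positivity
  have hM : lam * (8 * ((B + 1 : ℕ) : ℤ) + 20) ≤ 1 := by push_cast; nlinarith
  have hyl : (100 * B + 200 : ℤ) ≤ p.2 := large_of hl (r := r / 2) (by push_cast; linarith) hy
  obtain ⟨s1, s2, s3, s4, s5, s6⟩ := step_top hl hM hb (by omega) (by omega)
  have ss := step_small hl hM hb (by omega)
  refine ⟨s1, ?_⟩
  by_cases hcr : 0 ≤ sd ((Fe lam ^ 4) p)
  · exact Or.inr hcr
  left
  set q := (Fe lam ^ 4) p
  have hsd : sd q = q.1 - q.2 := rfl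
  simp only [abs_le] at ss
  push_cast at ss
  rcases h with ⟨h1, h2, h3, h4⟩ | ⟨h1, h2, h3, h4⟩
  · have s3 := s3 h1
    have s5 := s5 h1 h2
    have s3' : (p.2 : ℝ) ≤ q.2 := by exact_mod_cast s3
    have s5' : ((q.2 : ℝ) - p.2) ≤ q.1 - p.1 := by exact_mod_cast s5
    by_cases hq : q.1 < 0
    · left
      refine ⟨hq, by omega, by nlinarith, by nlinarith⟩
    · right
      refine ⟨by omega, by omega, ?_, Or.inl ?_⟩
      · have h5 : q.1 ≤ 2 * (B + 1) + 2 := by omega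
        have h5' : (q.1 : ℝ) ≤ 2 * (B + 1) + 2 := by exact_mod_cast h5
        nlinarith
      · have : (0 : ℝ) ≤ q.1 := by exact_mod_cast (by omega : 0 ≤ q.1)
        nlinarith
  · have s2 := s2 h1
    have s2' : (q.2 : ℝ) ≤ p.2 - 1 := by exact_mod_cast s2
    have s1' : (p.1 : ℝ) + 1 ≤ q.1 := by exact_mod_cast s1
    right
    refine ⟨by omega, by omega, by nlinarith, ?_⟩
    by_cases hx : r / 2 ≤ lam * (p.1 : ℝ)
    · right; nlinarith
    · left
      have s6 := s6 h1 (by linarith)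
      have s6' : (p.2 : ℝ) - 1 ≤ q.2 := by exact_mod_cast s6
      rcases h4 with h4 | h4
      · nlinarith
      · exact absurd h4 hx

/-- The number of near-grid points along an invariant stretch. -/
lemma count_near {lam r : ℝ} {B D : ℕ} {q : ℤ × ℤ} (hl : 0 < lam) (hr : 0 < r) (hr1 : r ≤ 1)
    (hlam : lam * (200 * B + 400) ≤ r) (hD : lam * D ≤ 1) (J : ℕ) (S : Finset ℕ)
    (hS : ∀ j ∈ S, j < J ∧ Near lam D ((Fe lam ^ (4 * j)) q))
    (h : ∀ j < J, InvR lam r B ((Fe lam ^ (4 * j)) q)) :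
    S.card ≤ 3 * ((2 * (B + 1) + 3) * (2 * D + 1)) + (B + 2) := by
  classical
  obtain ⟨T, hT, hTm⟩ := near_finset hl (B + 1) D hD
  have hB : (0 : ℝ) ≤ B := by positivity
  have hM : lam * (8 * ((B + 1 : ℕ) : ℤ) + 20) ≤ 1 := by push_cast; nlinarith
  set x : ℕ → ℤ := fun j => ((Fe lam ^ (4 * j)) q).1 with hx
  set y : ℕ → ℤ := fun j => ((Fe lam ^ (4 * j)) q).2 with hy
  have e : ∀ j, (Fe lam ^ 4) ((Fe lam ^ (4 * j)) q) = (Fe lam ^ (4 * (j + 1))) q := by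
    intro j; rw [← Fe_pow_add]; congr 2; ring
  have xs : ∀ j < J, x j + 1 ≤ x (j + 1) := by
    intro j hj
    have := (Inv_step hl hr hr1 hlam (h j hj)).1
    rwa [e] at this
  have ys : ∀ j < J, (0 ≤ x j → y (j + 1) ≤ y j - 1) ∧ (x j ≤ -(B + 2) → y j + 1 ≤ y (j + 1)) := by
    intro j hj
    obtain ⟨hb, hy, hs⟩ := Inv_facts hl hr (h j hj)
    have hyl : (100 * B + 200 : ℤ) ≤ ((Fe lam ^ (4 * j)) q).2 :=
      large_of hl (r := r / 2) (by push_cast; linarith) hy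
    obtain ⟨s1, s2, s3, s4, s5, s6⟩ := step_top hl hM hb (by omega) (by omega)
    rw [e] at s2 s4
    exact ⟨s2, fun h => s4 (by simp only [hx] at h; omega)⟩
  have bx : ∀ j < J, |lam * (x j : ℝ)| ≤ (B + 1 : ℕ) ∧ |lam * (y j : ℝ)| ≤ (B + 1 : ℕ) := by
    intro j hj
    obtain ⟨hb, -, -⟩ := Inv_facts hl hr (h j hj)
    exact_mod_cast hb
  have xmono : ∀ i j, i < j → j < J → x i < x j := by
    intro i j hij0
    have hij : i + 1 ≤ j := hij0
    clear hij0
    induction j, hij using Nat.le_induction with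
    | base => intro hj; have := xs i (by omega); omega
    | succ n hn ih => intro hj; have := ih (by omega); have := xs n (by omega); omega
  have y1mono : ∀ i j, i < j → j < J → x j ≤ -(B + 2) → y i < y j := by
    intro i j hij0
    have hij : i + 1 ≤ j := hij0
    clear hij0
    induction j, hij using Nat.le_induction with
    | base =>
      intro hj hxj
      have := xs i (by omega)
      have := (ys i (by omega)).2 (by omega); omega
    | succ n hn ih =>
      intro hj hxj
      have := xs n (by omega)
      have := ih (by omega) (by omega); have := (ys n (by omega)).2 (by omega); omega
  have y2mono : ∀ i j, i < j → j < J → 0 ≤ x i → y j < y i := by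
    intro i j hij0
    have hij : i + 1 ≤ j := hij0
    clear hij0
    induction j, hij using Nat.le_induction with
    | base =>
      intro hj hxj
      have := (ys i (by omega)).1 (by omega); omega
    | succ n hn ih =>
      intro hj hxj
      have := ih (by omega) hxj
      have := xmono i n (by omega) (by omega)
      have := (ys n (by omega)).1 (by omega); omega
  have sub : S ⊆ (S.filter (fun j => x j ∈ T)) ∪ (S.filter (fun j => y j ∈ T ∧ x j ≤ -(B + 2))) ∪
      (S.filter (fun j => y j ∈ T ∧ 0 ≤ x j)) ∪ (S.filter (fun j => x j ∈ Finset.Icc (-(B + 1 : ℤ)) 0)) := by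
    intro j hj
    simp only [Finset.mem_union, Finset.mem_filter, hj, true_and, Finset.mem_Icc]
    obtain ⟨hjJ, hn⟩ := hS j hj
    obtain ⟨bx, bY⟩ := bx j hjJ
    rcases hn with hn | hn
    · left; left; left
      exact hTm _ bx hn
    · have := hTm _ bY hn
      by_cases h1 : x j ≤ -(B + 2)
      · left; left; right; exact ⟨this, h1⟩
      · by_cases h2 : 0 ≤ x j
        · left; right; exact ⟨this, h2⟩
        · right; omega
  have c1 : (S.filter (fun j => x j ∈ T)).card ≤ T.card := by
    apply Finset.card_le_card_of_injOn x
    · intro j hj; exact (Finset.mem_filter.1 hj).2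
    · intro i hi j hj hij
      have hi := (hS i (Finset.mem_filter.1 hi).1).1
      have hj := (hS j (Finset.mem_filter.1 hj).1).1
      rcases lt_trichotomy i j with h | h | h
      · have := xmono i j h hj; omega
      · exact h
      · have := xmono j i h hi; omega
  have c4 : (S.filter (fun j => x j ∈ Finset.Icc (-(B + 1 : ℤ)) 0)).card ≤ B + 2 := by
    have : B + 2 = (Finset.Icc (-(B + 1 : ℤ)) 0).card := by rw [Int.card_Icc]; omega
    rw [this]
    apply Finset.card_le_card_of_injOn x
    · intro j hj; exact (Finset.mem_filter.1 hj).2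
    · intro i hi j hj hij
      have hi := (hS i (Finset.mem_filter.1 hi).1).1
      have hj := (hS j (Finset.mem_filter.1 hj).1).1
      rcases lt_trichotomy i j with h | h | h
      · have := xmono i j h hj; omega
      · exact h
      · have := xmono j i h hi; omega
  have c2 : (S.filter (fun j => y j ∈ T ∧ x j ≤ -(B + 2))).card ≤ T.card := by
    apply Finset.card_le_card_of_injOn y
    · intro j hj; exact (Finset.mem_filter.1 hj).2.1
    · intro i hi j hj hij
      have hi' := (Finset.mem_filter.1 hi).2.2
      have hj' := (Finset.mem_filter.1 hj).2.2
      have hi := (hS i (Finset.mem_filter.1 hi).1).1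
      have hj := (hS j (Finset.mem_filter.1 hj).1).1
      rcases lt_trichotomy i j with h | h | h
      · have := y1mono i j h hj hj'; omega
      · exact h
      · have := y1mono j i h hi hi'; omega
  have c3 : (S.filter (fun j => y j ∈ T ∧ 0 ≤ x j)).card ≤ T.card := by
    apply Finset.card_le_card_of_injOn y
    · intro j hj; exact (Finset.mem_filter.1 hj).2.1
    · intro i hi j hj hij
      have hi' := (Finset.mem_filter.1 hi).2.2
      have hj' := (Finset.mem_filter.1 hj).2.2
      have hi := (hS i (Finset.mem_filter.1 hi).1).1
      have hj := (hS j (Finset.mem_filter.1 hj).1).1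
      rcases lt_trichotomy i j with h | h | h
      · have := y2mono i j h hj hi'; omega
      · exact h
      · have := y2mono j i h hi hj'; omega
  have := Finset.card_le_card sub
  have := Finset.card_union_le ((S.filter (fun j => x j ∈ T)) ∪ (S.filter (fun j => y j ∈ T ∧ x j ≤ -(B + 2))) ∪
      (S.filter (fun j => y j ∈ T ∧ 0 ≤ x j))) (S.filter (fun j => x j ∈ Finset.Icc (-(B + 1 : ℤ)) 0))
  have := Finset.card_union_le ((S.filter (fun j => x j ∈ T)) ∪ (S.filter (fun j => y j ∈ T ∧ x j ≤ -(B + 2))))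
      (S.filter (fun j => y j ∈ T ∧ 0 ≤ x j))
  have := Finset.card_union_le (S.filter (fun j => x j ∈ T)) (S.filter (fun j => y j ∈ T ∧ x j ≤ -(B + 2)))
  omega

/-! ### Reaching the return domain -/

def Nm (lam ρ : ℝ) (p : ℤ × ℤ) : Prop := ρ ≤ |lam * (p.1 : ℝ)| ∨ ρ ≤ |lam * (p.2 : ℝ)|

lemma init_ok {lam r : ℝ} {R : ℕ} (hl : 0 < lam) (hr1 : r ≤ 1)
    (hlam : lam * (20 * (R + 2)) ≤ r) {p : ℤ × ℤ} (hb : Bd lam R p) (hn : Nm lam r p) (k : ℕ) (hk : k ≤ 8) :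
    Bd lam (R + 1 : ℕ) ((Fe lam ^ k) p) ∧ Nm lam (r / 2) ((Fe lam ^ k) p) := by
  have hR : (0 : ℝ) ≤ R := by positivity
  have hpos : 0 < lam * (R + 2) := by positivity
  have key : ∀ k : ℕ, k ≤ 8 → |lam * (((Fe lam ^ k) p).1 : ℝ)| ≤ R + k * (lam * (R + 2)) ∧
      |lam * (((Fe lam ^ k) p).2 : ℝ)| ≤ R + k * (lam * (R + 2)) ∧
      Nm lam (r - k * (lam * (R + 2))) ((Fe lam ^ k) p) := by
    intro k
    induction k with
    | zero =>
      intro _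
      obtain ⟨h1, h2⟩ := hb
      push_cast at h1 h2
      simp only [pow_zero, Equiv.Perm.coe_one, id_eq, Nat.cast_zero, zero_mul, add_zero, sub_zero]
      exact ⟨h1, h2, hn⟩
    | succ k ih =>
      intro hk
      obtain ⟨i1, i2, i3⟩ := ih (by omega)
      rw [Fe_pow_succ, Fe_apply]
      set q := (Fe lam ^ k) p
      have hk' : (k : ℝ) ≤ 8 := by exact_mod_cast (by omega : k ≤ 8)
      have hb1 : |lam * (q.1 : ℝ)| ≤ ((R + 1 : ℤ) : ℝ) := by push_cast; nlinarith
      have ha := floor_bd hb1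
      set a := ⌊lam * (q.1 : ℝ)⌋
      have ha' : |(a : ℝ)| ≤ R + 1 := by
        rw [abs_le]
        constructor
        · have := ha.1
          have h : ((-(R + 1) : ℤ) : ℝ) ≤ a := Int.cast_le.2 this
          push_cast at h; linarith
        · exact_mod_cast ha.2
      have hla : |lam * (a : ℝ)| ≤ lam * (R + 2) := by
        rw [abs_mul, abs_of_pos hl]; nlinarith
      have e : lam * ((a - q.2 : ℤ) : ℝ) = lam * a - lam * q.2 := by push_cast; ring
      refine ⟨?_, ?_, ?_⟩
      · simp only [e]
        have := abs_sub (lam * (a : ℝ)) (lam * q.2)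
        push_cast
        linarith
      · simp only
        push_cast
        linarith
      · rcases i3 with i3 | i3
        · right
          simp only
          push_cast
          linarith
        · left
          simp only [e]
          have := abs_sub_abs_le_abs_sub (lam * q.2) (lam * (a : ℝ))
          rw [abs_sub_comm] at this
          push_cast
          linarith
  have hk' : (k : ℝ) ≤ 8 := by exact_mod_cast hk
  obtain ⟨i1, i2, i3⟩ := key k hk
  clear key
  generalize (Fe lam ^ k) p = q at *
  refine ⟨⟨?_, ?_⟩, ?_⟩
  · push_cast; nlinarith
  · push_cast; nlinarith
  · rcases i3 with i3 | i3
    · left; nlinarith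
    · right; nlinarith

lemma init_inv {lam r : ℝ} {R : ℕ} (hl : 0 < lam) (hr1 : r ≤ 1)
    (hlam : lam * (20 * (R + 2)) ≤ r) {p : ℤ × ℤ} (hb : Bd lam R p) (hn : Nm lam r p) :
    ∃ i : ℕ, 1 ≤ i ∧ i ≤ 6 ∧ InvR lam (r / 2) (2 * R + 2) ((Fe lam ^ i) p) := by
  have ok := fun k hk => init_ok hl hr1 hlam hb hn k hk
  have hR : (0 : ℝ) ≤ R := by positivity
  -- the sector
  suffices H : ∃ i : ℕ, 1 ≤ i ∧ i ≤ 6 ∧ -((Fe lam ^ i) p).1 ≤ ((Fe lam ^ i) p).2 ∧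
      ((Fe lam ^ i) p).1 < ((Fe lam ^ i) p).2 by
    obtain ⟨i, hi1, hi6, h1, h2⟩ := H
    refine ⟨i, hi1, hi6, ?_⟩
    obtain ⟨⟨b1, b2⟩, n⟩ := ok i (by omega)
    set q := (Fe lam ^ i) p
    have h1' : (-q.1 : ℝ) ≤ q.2 := by exact_mod_cast h1
    have h2' : (q.1 : ℝ) < q.2 := by exact_mod_cast h2
    have hq2 : (0 : ℝ) < q.2 := by linarith
    have hn' : r / 2 ≤ lam * q.2 := by
      rcases n with n | n
      · refine n.trans ?_
        rw [abs_le]; constructor <;> nlinarith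
      · rwa [abs_of_pos (by positivity)] at n
    rw [abs_le] at b1 b2
    push_cast at b1 b2
    by_cases hx : q.1 < 0
    · left
      refine ⟨hx, h1, hn', ?_⟩
      push_cast; nlinarith
    · right
      have hx' : (0 : ℝ) ≤ q.1 := by exact_mod_cast (by omega : 0 ≤ q.1)
      refine ⟨by omega, h2, ?_, Or.inl ?_⟩
      · push_cast; nlinarith
      · nlinarith
  have st : ∀ k, k ≤ 8 → ∃ a : ℤ, (Fe lam ^ (k + 1)) p = (a - ((Fe lam ^ k) p).2, ((Fe lam ^ k) p).1) ∧
      -(R + 1) ≤ a ∧ a ≤ R + 1 ∧ (0 ≤ ((Fe lam ^ k) p).1 → 0 ≤ a) ∧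
      (((Fe lam ^ k) p).1 < 0 → a ≤ -1) ∧
      (4 * (R + 1) ≤ |((Fe lam ^ k) p).1| ∨ 4 * (R + 1) ≤ |((Fe lam ^ k) p).2|) := by
    intro k hk
    obtain ⟨b, n⟩ := ok k hk
    refine ⟨⌊lam * (((Fe lam ^ k) p).1 : ℝ)⌋, ?_, ?_, ?_, ?_, ?_, ?_⟩
    · rw [Fe_pow_succ, Fe_apply]
    · have := (floor_bd b.1).1; omega
    · have := (floor_bd b.1).2; omega
    · exact fun h => floor_nonneg_of hl h
    · exact fun h => floor_neg_of hl h
    · rcases n with n | n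
      · left
        apply large_of hl (r := r / 2)
        · push_cast; nlinarith
        · rw [abs_mul, abs_of_pos hl] at n
          rw [Int.cast_abs]; exact n
      · right
        apply large_of hl (r := r / 2)
        · push_cast; nlinarith
        · rw [abs_mul, abs_of_pos hl] at n
          rw [Int.cast_abs]; exact n
  set x : ℕ → ℤ := fun k => ((Fe lam ^ k) p).1 with hx
  set y : ℕ → ℤ := fun k => ((Fe lam ^ k) p).2 with hy
  have st' : ∀ k, k ≤ 8 → ∃ a : ℤ, x (k + 1) = a - y k ∧ y (k + 1) = x k ∧
      -(R + 1) ≤ a ∧ a ≤ R + 1 ∧ (0 ≤ x k → 0 ≤ a) ∧ (x k < 0 → a ≤ -1) ∧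
      (4 * (R + 1) ≤ |x k| ∨ 4 * (R + 1) ≤ |y k|) := by
    intro k hk
    obtain ⟨a, h, h'⟩ := st k hk
    exact ⟨a, by simp only [hx, hy, h], by simp only [hx, hy, h], h'⟩
  clear st ok
  have c1 : ∀ k, 1 ≤ k → k ≤ 5 → 0 ≤ x k → 0 ≤ y k → ∃ i, 1 ≤ i ∧ i ≤ 6 ∧ -x i ≤ y i ∧ x i < y i := by
    intro k hk1 hk hxk hyk
    obtain ⟨a, h1, h2, h3, h4, h5, h6, h7⟩ := st' k (by omega)
    rw [abs_of_nonneg hxk, abs_of_nonneg hyk] at h7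
    have := h5 hxk
    by_cases hc : x k < y k
    · exact ⟨k, by omega, by omega, by omega, hc⟩
    · exact ⟨k + 1, by omega, by omega, by omega, by omega⟩
  have c4 : ∀ k, 1 ≤ k → k ≤ 4 → 0 ≤ x k → y k ≤ 0 → ∃ i, 1 ≤ i ∧ i ≤ 6 ∧ -x i ≤ y i ∧ x i < y i := by
    intro k hk1 hk hxk hyk
    obtain ⟨a, h1, h2, h3, h4, h5, h6, h7⟩ := st' k (by omega)
    have := h5 hxk
    exact c1 (k + 1) (by omega) (by omega) (by omega) (by omega)
  have c3 : ∀ k, 1 ≤ k → k ≤ 2 → x k < 0 → y k ≤ 0 → ∃ i, 1 ≤ i ∧ i ≤ 6 ∧ -x i ≤ y i ∧ x i < y i := by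
    intro k hk1 hk hxk hyk
    obtain ⟨a, h1, h2, h3, h4, h5, h6, h7⟩ := st' k (by omega)
    by_cases hc : 0 ≤ x (k + 1)
    · exact c4 (k + 1) (by omega) (by omega) hc (by omega)
    · obtain ⟨a', h1', h2', h3', h4', h5', h6', h7'⟩ := st' (k + 1) (by omega)
      rw [abs_of_neg hxk, abs_of_nonpos hyk] at h7
      exact c4 (k + 1 + 1) (by omega) (by omega) (by omega) (by omega)
  obtain ⟨a, h1, h2, h3, h4, h5, h6, h7⟩ := st' 1 (by omega)
  by_cases hx1 : 0 ≤ x 1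
  · by_cases hy1 : 0 ≤ y 1
    · exact c1 1 (by omega) (by omega) hx1 hy1
    · exact c4 1 (by omega) (by omega) hx1 (by omega)
  · by_cases hy1 : y 1 ≤ 0
    · exact c3 1 (by omega) (by omega) (by omega) hy1
    · have := h6 (by omega)
      exact c3 (1 + 1) (by omega) (by omega) (by omega) (by omega)

lemma traj {lam r : ℝ} {B : ℕ} {q : ℤ × ℤ} (hl : 0 < lam) (hr : 0 < r) (hr1 : r ≤ 1)
    (hlam : lam * (200 * B + 400) ≤ r) (h : InvR lam r B q) :
    ∃ J : ℕ, (∀ j ≤ J, InvR lam r B ((Fe lam ^ (4 * j)) q)) ∧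
      0 ≤ sd ((Fe lam ^ (4 * (J + 1))) q) := by
  classical
  have e : ∀ j, (Fe lam ^ 4) ((Fe lam ^ (4 * j)) q) = (Fe lam ^ (4 * (j + 1))) q := by
    intro j; rw [← Fe_pow_add]; congr 2; ring
  have ex : ∃ j, ¬ InvR lam r B ((Fe lam ^ (4 * j)) q) := by
    by_contra hcon
    push Not at hcon
    have grow : ∀ j : ℕ, q.1 + j ≤ ((Fe lam ^ (4 * j)) q).1 := by
      intro j
      induction j with
      | zero => simp
      | succ j ih =>
        have := (Inv_step hl hr hr1 hlam (hcon j)).1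
        rw [e] at this
        rw [Nat.cast_succ]
        omega
    obtain ⟨n, hn⟩ := exists_nat_gt ((B + 1 : ℝ) / lam - q.1)
    have h1 := (Inv_facts hl hr (hcon n)).1.1
    have h2 : ((q.1 : ℝ) + n) ≤ (((Fe lam ^ (4 * n)) q).1 : ℝ) := by exact_mod_cast grow n
    have h3 := (abs_le.1 h1).2
    rw [sub_lt_iff_lt_add, div_lt_iff₀ hl] at hn
    have h4 : (((B + 1 : ℕ) : ℤ) : ℝ) = B + 1 := by push_cast; ring
    rw [h4] at h3
    nlinarith
  have hspec := Nat.find_spec ex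
  have hmin := fun m => Nat.find_min ex (m := m)
  obtain ⟨J, hJ⟩ : ∃ J, Nat.find ex = J + 1 := by
    refine ⟨Nat.find ex - 1, ?_⟩
    have : Nat.find ex ≠ 0 := by
      intro h0
      rw [h0] at hspec
      exact hspec (by simpa using h)
    omega
  rw [hJ] at hspec hmin
  refine ⟨J, fun j hj => ?_, ?_⟩
  · have := hmin j (by omega)
    push Not at this
    exact this
  · have := (Inv_step hl hr hr1 hlam (by simpa using hmin J (by omega))).2
    rw [e] at this
    tauto

lemma Nm_shift {lam ρ : ℝ} (hl : 0 < lam) {y e E : ℤ} (hy : ρ ≤ lam * (y : ℝ)) (he : |e| ≤ E)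
    (hE : lam * E ≤ ρ / 2) :
    ρ / 2 ≤ |lam * ((e + y : ℤ) : ℝ)| ∧ ρ / 2 ≤ |lam * ((e - y : ℤ) : ℝ)| := by
  have h1 : |(e : ℝ)| ≤ E := by exact_mod_cast he
  rw [abs_le] at h1
  push_cast
  constructor
  · exact le_trans (by nlinarith) (le_abs_self _)
  · exact le_trans (by nlinarith) (neg_le_abs _)

/-- Points of the `F`-orbit between consecutive `F⁴` steps. -/
lemma between {lam r : ℝ} {B : ℕ} {q : ℤ × ℤ} (hl : 0 < lam) (hr : 0 < r) (hr1 : r ≤ 1)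
    (hlam : lam * (200 * B + 400) ≤ r) (h : InvR lam r B q) (l : ℕ) (hl4 : l ≤ 4) :
    Bd lam (B + 2 : ℕ) ((Fe lam ^ l) q) ∧ Nm lam (r / 4) ((Fe lam ^ l) q) ∧
    (l < 4 → ∀ D, Near lam D ((Fe lam ^ l) q) → Near lam (D + (2 * B + 4)) q) := by
  obtain ⟨hb, hy, hs⟩ := Inv_facts hl hr h
  obtain ⟨x, y⟩ := q
  have hB : (0 : ℝ) ≤ B := by positivity
  have hM : lam * (8 * ((B + 1 : ℕ) : ℤ) + 20) ≤ 1 := by push_cast; nlinarith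
  obtain ⟨a, b, c, d, ha, hb', hc, hd, h1, h2, h3, h4, Ba, Bb, Bc, Bdd⟩ := F4_bd hl hM hb (by omega)
  have E1 : lam * ((2 * B + 4 : ℤ) : ℝ) ≤ 1 := by push_cast; nlinarith
  have E2 : lam * ((2 * B + 4 : ℤ) : ℝ) ≤ (r / 2) / 2 := by push_cast; nlinarith
  have e0 : r / 4 = (r / 2) / 2 := by ring
  obtain ⟨bx, bY⟩ := hb
  simp only at bx bY hy
  have sh1 : ∀ e z : ℤ, |lam * (z : ℝ)| ≤ ((B + 1 : ℕ) : ℤ) → |e| ≤ 2 * B + 4 →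
      |lam * ((e + z : ℤ) : ℝ)| ≤ ((B + 2 : ℕ) : ℤ) := by
    intro e z hz he
    have := bd_mul hl hz he E1
    simpa [add_assoc, one_add_one_eq_two] using this
  have sh2 : ∀ e z : ℤ, |lam * (z : ℝ)| ≤ ((B + 1 : ℕ) : ℤ) → |e| ≤ 2 * B + 4 →
      |lam * ((e - z : ℤ) : ℝ)| ≤ ((B + 2 : ℕ) : ℤ) := by
    intro e z hz he
    rw [sub_eq_add_neg]
    apply sh1 _ _ _ he
    push_cast
    rw [mul_neg, abs_neg]
    exact_mod_cast hz
  have n1 : ∀ e z : ℤ, ∀ D, NearC lam D (e + z) → |e| ≤ 2 * B + 4 → NearC lam (D + (2 * B + 4)) z := by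
    intro e z D h he
    exact NearC_add hl h (by push_cast; exact he)
  have n2 : ∀ e z : ℤ, ∀ D, NearC lam D (e - z) → |e| ≤ 2 * B + 4 → NearC lam (D + (2 * B + 4)) z := by
    intro e z D h he
    rw [sub_eq_add_neg] at h
    exact NearC_neg (n1 _ _ _ h he)
  have ea : |a| ≤ 2 * B + 4 := by rw [abs_le]; omega
  have eb : |b| ≤ 2 * B + 4 := by rw [abs_le]; omega
  have eca : |c - a| ≤ 2 * B + 4 := by rw [abs_le]; omega
  have edb : |d - b| ≤ 2 * B + 4 := by rw [abs_le]; omega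
  have n0 : ∀ z : ℤ, ∀ D, NearC lam D z → NearC lam (D + (2 * B + 4)) z := by
    intro z D h
    exact NearC_mono hl h (by omega)
  have bx0 := sh1 0 x bx (by simp; omega)
  have by0 := sh1 0 y bY (by simp; omega)
  simp only [zero_add] at bx0 by0
  interval_cases l
  · simp only [pow_zero, Equiv.Perm.coe_one, id_eq]
    refine ⟨⟨bx0, by0⟩, Or.inr ?_, fun _ D h => h.imp (n0 _ _) (n0 _ _)⟩
    exact le_trans (by linarith) (le_abs_self _)
  · rw [pow_one, h1]
    refine ⟨⟨sh2 _ _ bY ea, bx0⟩, Or.inl ?_, fun _ D h => ?_⟩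
    · rw [e0]; exact (Nm_shift hl hy ea E2).2
    · rcases h with h | h
      · exact Or.inr (n2 _ _ _ h ea)
      · exact Or.inl (n0 _ _ h)
  · rw [h2]
    refine ⟨⟨sh2 _ _ bx eb, sh2 _ _ bY ea⟩, Or.inr ?_, fun _ D h => ?_⟩
    · rw [e0]; exact (Nm_shift hl hy ea E2).2
    · rcases h with h | h
      · exact Or.inl (n2 _ _ _ h eb)
      · exact Or.inr (n2 _ _ _ h ea)
  · rw [h3]
    refine ⟨⟨sh1 _ _ bY eca, sh2 _ _ bx eb⟩, Or.inl ?_, fun _ D h => ?_⟩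
    · rw [e0]; exact (Nm_shift hl hy eca E2).1
    · rcases h with h | h
      · exact Or.inr (n1 _ _ _ h eca)
      · exact Or.inl (n2 _ _ _ h eb)
  · rw [h4]
    refine ⟨⟨sh1 _ _ bx edb, sh1 _ _ bY eca⟩, Or.inr ?_, fun h => absurd h (by omega)⟩
    rw [e0]; exact (Nm_shift hl hy eca E2).1

lemma fwd {lam r : ℝ} {R D : ℕ} (hl : 0 < lam) (hr : 0 < r) (hr1 : r ≤ 1)
    (hlam : lam * (1000 * (R + 2)) ≤ r) (hD : lam * (D + (4 * R + 8)) ≤ 1) {p : ℤ × ℤ}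
    (hb : Bd lam R p) (hn : Nm lam r p) :
    ∃ K : ℕ, (∃ k : ℕ, 1 ≤ k ∧ k ≤ K ∧ (Fe lam ^ k) p ∈ Xset lam) ∧
      (∃ k : ℕ, 1 ≤ k ∧ k ≤ K ∧ ((Fe lam ^ k) p).swap ∈ Xset lam) ∧
      (∀ k ≤ K, Bd lam (2 * R + 4 : ℕ) ((Fe lam ^ k) p) ∧ Nm lam (r / 8) ((Fe lam ^ k) p)) ∧
      ∀ S : Finset ℕ, (∀ k ∈ S, k ≤ K ∧ Near lam D ((Fe lam ^ k) p)) →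
        S.card ≤ 7 + 4 * (3 * ((2 * (2 * R + 2 + 1) + 3) * (2 * (D + (4 * R + 8)) + 1)) + (2 * R + 2 + 2)) := by
  classical
  have hR : (0 : ℝ) ≤ R := by positivity
  have hlam1 : lam * (20 * (R + 2)) ≤ r := by nlinarith
  have hlam2 : lam * (200 * ((2 * R + 2 : ℕ) : ℝ) + 400) ≤ r / 2 := by push_cast; nlinarith
  obtain ⟨i, hi1, hi6, hI⟩ := init_inv hl hr1 hlam1 hb hn
  obtain ⟨J, hJ, hcr⟩ := traj hl (half_pos hr) (by linarith) hlam2 hI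
  set q := (Fe lam ^ i) p with hq
  have comp : ∀ j l, (Fe lam ^ (l + 4 * j + i)) p = (Fe lam ^ l) ((Fe lam ^ (4 * j)) q) := by
    intro j l; rw [Fe_pow_add, Fe_pow_add]
  set B := 2 * R + 2 with hB
  -- crossing
  set u := (Fe lam ^ (4 * J)) q with hu
  obtain ⟨bu, hyu, hsu⟩ := Inv_facts hl (half_pos hr) (hJ J le_rfl)
  rw [← hu] at bu hyu hsu
  have bw := fun l hl4 => between hl (half_pos hr) (by linarith) hlam2 (hJ J le_rfl) l hl4
  rw [← hu] at bw
  have e1 : (Fe lam ^ 4) u = (Fe lam ^ (4 * (J + 1))) q := by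
    rw [hu, ← Fe_pow_add]; congr 2; ring
  rw [← e1] at hcr
  have hM : lam * (8 * ((B + 2 : ℕ) : ℤ) + 20) ≤ 1 := by rw [hB]; push_cast; nlinarith
  have b0 := (bw 0 (by omega)).1
  have b4 := (bw 4 (by omega)).1
  rw [pow_zero] at b0
  have hyl : (100 * B + 200 : ℤ) ≤ u.2 := by
    apply large_of hl (r := r / 2 / 2) _ hyu
    push_cast at hlam2 ⊢
    linarith
  have ss := step_small hl hM b0 (by omega)
  simp only [abs_le] at ss
  have hxl : (6 * ((B + 2 : ℕ) : ℤ) + 6) ≤ u.1 := by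
    simp only [sd, Equiv.Perm.coe_one, id_eq] at hcr ss
    omega
  obtain ⟨cr1, cr2⟩ := cross hl hM (by omega) b0 b4 hxl (by simp only [Equiv.Perm.coe_one, id_eq]; omega) hsu hcr
  simp only [Equiv.Perm.coe_one, id_eq] at cr1 cr2
  have eu : (Fe lam ^ (4 * J + i)) p = u := by rw [Fe_pow_add]
  have eu4 : (Fe lam ^ (4 + 4 * J + i)) p = (Fe lam ^ 4) u := by rw [comp]
  refine ⟨4 + 4 * J + i, ?_, ?_, ?_, ?_⟩
  · rcases cr1 with h | h
    · exact ⟨4 * J + i, by omega, by omega, by rwa [eu]⟩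
    · exact ⟨4 + 4 * J + i, by omega, by omega, by rwa [eu4]⟩
  · rcases cr2 with h | h
    · exact ⟨4 * J + i, by omega, by omega, by rwa [eu]⟩
    · exact ⟨4 + 4 * J + i, by omega, by omega, by rwa [eu4]⟩
  · intro k hk
    by_cases hki : k < i
    · obtain ⟨⟨h1, h2⟩, h3⟩ := init_ok hl hr1 hlam1 hb hn k (by omega)
      have hc : (((R + 1 : ℕ) : ℤ) : ℝ) ≤ ((2 * R + 4 : ℕ) : ℤ) := by push_cast; linarith
      refine ⟨⟨h1.trans hc, h2.trans hc⟩, h3.imp (fun h => ?_) (fun h => ?_)⟩ <;> linarith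
    · obtain ⟨j, l, hj, hl4, rfl⟩ : ∃ j l : ℕ, j ≤ J ∧ l ≤ 4 ∧ k = l + 4 * j + i := by
        by_cases h : k = 4 + 4 * J + i
        · exact ⟨J, 4, le_rfl, le_rfl, h⟩
        · exact ⟨(k - i) / 4, (k - i) % 4, by omega, by omega, by omega⟩
      rw [comp]
      obtain ⟨h1, h2, -⟩ := between hl (half_pos hr) (by linarith) hlam2 (hJ j hj) l hl4
      refine ⟨h1, ?_⟩
      rw [show r / 8 = r / 2 / 4 by ring]
      exact h2
  · intro S hS
    set N := (Finset.range (J + 1)).filter (fun j => Near lam (D + (2 * B + 4)) ((Fe lam ^ (4 * j)) q)) with hN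
    have hD' : lam * ((D + (2 * B + 4) : ℕ) : ℝ) ≤ 1 := by
      rw [hB]; push_cast; nlinarith
    have hNc := count_near hl (half_pos hr) (by linarith) hlam2 hD' (J + 1) N
      (fun j hj => by
        rw [hN, Finset.mem_filter, Finset.mem_range] at hj; exact hj)
      (fun j hj => hJ j (by omega))
    have sub : S ⊆ Finset.range i ∪ {4 + 4 * J + i} ∪
        (N ×ˢ Finset.range 4).image (fun jl => jl.2 + 4 * jl.1 + i) := by
      intro k hk
      obtain ⟨hkK, hnear⟩ := hS k hk
      simp only [Finset.mem_union, Finset.mem_range, Finset.mem_singleton, Finset.mem_image,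
        Finset.mem_product]
      by_cases h1 : k < i
      · exact Or.inl (Or.inl h1)
      by_cases h2 : k = 4 + 4 * J + i
      · exact Or.inl (Or.inr h2)
      right
      refine ⟨((k - i) / 4, (k - i) % 4), ⟨?_, by simp only; omega⟩, by simp only; omega⟩
      have hk' : k = (k - i) % 4 + 4 * ((k - i) / 4) + i := by omega
      rw [hk', comp] at hnear
      have hjJ : (k - i) / 4 ≤ J := by omega
      have := (between hl (half_pos hr) (by linarith) hlam2 (hJ _ hjJ) ((k - i) % 4) (by omega)).2.2
        (by omega) D hnear
      rw [hN, Finset.mem_filter, Finset.mem_range]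
      exact ⟨by simp only; omega, this⟩
    have s1 := Finset.card_le_card sub
    have s2 := Finset.card_union_le (Finset.range i ∪ {4 + 4 * J + i})
        ((N ×ˢ Finset.range 4).image (fun jl => jl.2 + 4 * jl.1 + i))
    have s3 := Finset.card_union_le (Finset.range i) {4 + 4 * J + i}
    have s4 : ((N ×ˢ Finset.range 4).image (fun jl => jl.2 + 4 * jl.1 + i)).card ≤ N.card * 4 := by
      refine Finset.card_image_le.trans ?_
      rw [Finset.card_product, Finset.card_range]
    rw [Finset.card_range, Finset.card_singleton] at s3
    have e8 : 2 * B + 4 = 4 * R + 8 := by omega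
    rw [e8] at hNc
    omega

/-! ### Assembly -/

lemma Fe_zpow_add (lam : ℝ) (k l : ℤ) (p : ℤ × ℤ) :
    (Fe lam ^ (k + l)) p = (Fe lam ^ k) ((Fe lam ^ l) p) := by
  rw [zpow_add]; rfl

lemma Near_swap {lam : ℝ} {D : ℕ} {p : ℤ × ℤ} (h : Near lam D p.swap) : Near lam D p := Or.symm h

/-- Quantitative form: boundedly many exceptional points, and at least `c/λ` points in total. -/
lemma quant {lam r : ℝ} {R : ℕ} (hl : 0 < lam) (hr : 0 < r) (hr1 : r ≤ 1)
    (hlam : lam * (10000 * (R + 10)) ≤ r) {p : ℤ × ℤ} (hb : Bd lam R p) (hn : Nm lam r p) {C : ℕ}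
    (hC : C = 7 + 4 * (3 * ((2 * (2 * R + 2 + 1) + 3) * (2 * (4 * R + 10 + (4 * R + 8)) + 1)) + (2 * R + 2 + 2))) :
    (retOrbit lam p).Finite ∧ ({q | q ∈ retOrbit lam p ∧ ¬ vcond lam q} : Set (ℤ × ℤ)).ncard ≤ 2 * C ∧
    r / (400 * (R + 3)) / lam - 1 ≤ ((retOrbit lam p).ncard : ℝ) := by
  classical
  have hR : (0 : ℝ) ≤ R := by positivity
  have hlam1 : lam * (1000 * (R + 2)) ≤ r := by nlinarith
  have hD : lam * (((4 * R + 10 : ℕ) : ℝ) + (4 * R + 8)) ≤ 1 := by push_cast; nlinarith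
  have hM : lam * (8 * ((2 * R + 4 : ℕ) : ℝ) + 20) ≤ 1 := by push_cast; nlinarith
  obtain ⟨K1, ⟨k1, hk1, hk1', hX1⟩, -, hB1, hS1⟩ := fwd hl hr hr1 hlam1 hD hb hn
  obtain ⟨K2, -, ⟨k2, hk2, hk2', hX2⟩, hB2, hS2⟩ := fwd hl hr hr1 hlam1 hD (Bd_swap hb)
    (show Nm lam r p.swap from Or.symm hn)
  rw [← hC] at hS1 hS2
  -- transit times
  have tp_mem := Nat.sInf_mem (s := {k : ℕ | 1 ≤ k ∧ (Fe lam ^ (k : ℤ)) p ∈ Xset lam})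
    ⟨k1, hk1, by rw [zpow_natCast]; exact hX1⟩
  have tp_le : tauPlus lam p ≤ k1 := Nat.sInf_le ⟨hk1, by rw [zpow_natCast]; exact hX1⟩
  have hX2' : (Fe lam ^ (-(k2 : ℤ))) p ∈ Xset lam := by rw [Fe_neg]; exact hX2
  have tm_mem := Nat.sInf_mem (s := {k : ℕ | (Fe lam ^ (-(k : ℤ))) p ∈ Xset lam}) ⟨k2, hX2'⟩
  have tm_le : tauMinus lam p ≤ k2 := Nat.sInf_le hX2'
  have tp_min : ∀ k : ℕ, 1 ≤ k → k < tauPlus lam p → (Fe lam ^ (k : ℤ)) p ∉ Xset lam := by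
    intro k h1 h2 h3
    have h4 : tauPlus lam p ≤ k := Nat.sInf_le ⟨h1, h3⟩
    omega
  have tm_min : ∀ k : ℕ, k < tauMinus lam p → (Fe lam ^ (-(k : ℤ))) p ∉ Xset lam := by
    intro k h2 h3
    have h4 : tauMinus lam p ≤ k := Nat.sInf_le h3
    omega
  change 1 ≤ tauPlus lam p ∧ (Fe lam ^ (tauPlus lam p : ℤ)) p ∈ Xset lam at tp_mem
  change (Fe lam ^ (-(tauMinus lam p : ℤ))) p ∈ Xset lam at tm_mem
  have hfin : (retOrbit lam p).Finite := by
    refine ((Finset.Icc (-(tauMinus lam p : ℤ)) (tauPlus lam p)).image (fun k => (Fe lam ^ k) p)).finite_toSet.subset ?_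
    rintro q ⟨k, h1, h2, rfl⟩
    rw [Finset.coe_image]
    exact ⟨k, by simp [h1, h2], rfl⟩
  set τ := tauPlus lam p with hτ
  set τm := tauMinus lam p with hτm
  refine ⟨hfin, ?_, ?_⟩
  · -- exceptional points
    set S1 := (Finset.range (K1 + 1)).filter (fun k => Near lam (4 * R + 10) ((Fe lam ^ k) p)) with hS1d
    set S2 := (Finset.range (K2 + 1)).filter (fun k => Near lam (4 * R + 10) ((Fe lam ^ k) p.swap)) with hS2d
    have c1 : S1.card ≤ C := hS1 S1 (fun k hk => by
      rw [hS1d, Finset.mem_filter, Finset.mem_range] at hk; exact ⟨by omega, hk.2⟩)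
    have c2 : S2.card ≤ C := hS2 S2 (fun k hk => by
      rw [hS2d, Finset.mem_filter, Finset.mem_range] at hk; exact ⟨by omega, hk.2⟩)
    have sub : {q | q ∈ retOrbit lam p ∧ ¬ vcond lam q} ⊆
        ((S1.image (fun k => (Fe lam ^ k) p) ∪ S2.image (fun k => ((Fe lam ^ k) p.swap).swap) :
          Finset (ℤ × ℤ)) : Set (ℤ × ℤ)) := by
      rintro q ⟨⟨k, h1, h2, rfl⟩, hv⟩
      rw [Finset.mem_coe, Finset.mem_union, Finset.mem_image, Finset.mem_image]
      rcases le_or_gt 0 k with hk | hk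
      · left
        obtain ⟨n, rfl⟩ := Int.eq_ofNat_of_zero_le hk
        rw [zpow_natCast] at hv
        refine ⟨n, ?_, by rw [zpow_natCast]⟩
        have hnK : n ≤ K1 := by omega
        rw [hS1d, Finset.mem_filter, Finset.mem_range]
        exact ⟨by omega, near_of_not_vcond hl hM (by omega) (hB1 n hnK).1 hv⟩
      · right
        obtain ⟨n, rfl⟩ : ∃ n : ℕ, k = -(n : ℤ) := ⟨k.natAbs, by omega⟩
        rw [Fe_neg] at hv
        refine ⟨n, ?_, by rw [Fe_neg]⟩
        have hnK : n ≤ K2 := by omega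
        rw [hS2d, Finset.mem_filter, Finset.mem_range]
        exact ⟨by omega, Near_swap (near_of_not_vcond hl hM (by omega) (Bd_swap (hB2 n hnK).1) hv)⟩
    have := Set.ncard_le_ncard sub (Finset.finite_toSet _)
    rw [Set.ncard_coe_finset] at this
    have h3 := Finset.card_union_le (S1.image (fun k => (Fe lam ^ k) p)) (S2.image (fun k => ((Fe lam ^ k) p.swap).swap))
    have h4 : (S1.image (fun k => (Fe lam ^ k) p)).card ≤ S1.card := Finset.card_image_le
    have h5 : (S2.image (fun k => ((Fe lam ^ k) p.swap).swap)).card ≤ S2.card := Finset.card_image_le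
    omega
  · -- total number of points
    have hcard : τ + τm ≤ (retOrbit lam p).ncard := by
      have himg : (((Finset.Ico (-(τm : ℤ)) τ).image (fun k => (Fe lam ^ k) p) : Finset (ℤ × ℤ)) : Set (ℤ × ℤ)) ⊆
          retOrbit lam p := by
        intro q hq
        rw [Finset.mem_coe, Finset.mem_image] at hq
        obtain ⟨k, hk, rfl⟩ := hq
        rw [Finset.mem_Ico] at hk
        exact ⟨k, hk.1, hk.2.le, rfl⟩
      have h1 := Set.ncard_le_ncard himg hfin
      rw [Set.ncard_coe_finset, Finset.card_image_of_injOn, Int.card_Ico] at h1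
      · omega
      · have main : ∀ k l : ℤ, -(τm : ℤ) ≤ k → k < l → l < τ → (Fe lam ^ k) p ≠ (Fe lam ^ l) p := by
          intro k l hk hkl hlτ heq
          have h2 : (Fe lam ^ (-(τm : ℤ))) p = (Fe lam ^ (-(τm : ℤ) + (l - k))) p := by
            have a1 : (-(τm : ℤ)) = (-(τm : ℤ) - k) + k := by ring
            have a2 : (-(τm : ℤ) + (l - k)) = (-(τm : ℤ) - k) + l := by ring
            rw [a2, Fe_zpow_add, ← heq, ← Fe_zpow_add, ← a1]
          rw [h2] at tm_mem
          rcases le_or_gt (-(τm : ℤ) + (l - k)) 0 with h | h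
          · obtain ⟨n, hn⟩ : ∃ n : ℕ, -(τm : ℤ) + (l - k) = -(n : ℤ) :=
              ⟨(-(τm : ℤ) + (l - k)).natAbs, by omega⟩
            rw [hn] at tm_mem
            exact tm_min n (by omega) tm_mem
          · obtain ⟨n, hn⟩ : ∃ n : ℕ, -(τm : ℤ) + (l - k) = (n : ℤ) :=
              ⟨(-(τm : ℤ) + (l - k)).natAbs, by omega⟩
            rw [hn] at tm_mem
            exact tp_min n (by omega) (by omega) tm_mem
        intro k hk l hl heq
        rw [Finset.mem_coe, Finset.mem_Ico] at hk hl
        rcases lt_trichotomy k l with h | h | h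
        · exact absurd heq (main k l hk.1 h hl.2)
        · exact h
        · exact absurd heq.symm (main l k hl.1 h hk.2)
    -- first return
    set q0 := (Fe lam ^ (-(τm : ℤ))) p with hq0
    obtain ⟨b0, n0⟩ := hB2 τm (by omega)
    have q0e : q0 = ((Fe lam ^ τm) p.swap).swap := by rw [hq0, Fe_neg]
    have b0' : Bd lam (((2 * R + 5 : ℕ) : ℤ) - 1) q0 := by
      rw [q0e]
      have e : (((2 * R + 5 : ℕ) : ℤ) - 1) = ((2 * R + 4 : ℕ) : ℤ) := by push_cast; ring
      rw [e]
      exact Bd_swap b0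
    have n0' : Nm lam (r / 8) q0 := by rw [q0e]; exact Or.symm n0
    set L : ℤ := ⌊r / (16 * lam)⌋ with hL
    set c : ℝ := r / (400 * (R + 3)) with hc
    have hcpos : 0 < c := by positivity
    set T : ℤ := ⌊c / lam⌋ with hT
    have L1 : (L : ℝ) ≤ r / (16 * lam) := Int.floor_le _
    have L2 : r / (16 * lam) - 1 < L := Int.sub_one_lt_floor _
    have T1 : (T : ℝ) ≤ c / lam := Int.floor_le _
    have T2 : c / lam - 1 < T := Int.sub_one_lt_floor _
    have L1' : lam * L ≤ r / 16 := by
      rw [le_div_iff₀ (by positivity)] at L1; linarith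
    have L2' : r / 16 - lam < lam * L := by
      have : r / (16 * lam) < L + 1 := by linarith
      rw [div_lt_iff₀ (by positivity)] at this; linarith
    have T1' : lam * T ≤ c := by
      rw [le_div_iff₀ hl] at T1; linarith
    have hcR : c * (400 * (R + 3)) = r := by
      rw [hc]; field_simp
    have hLbig : 20 * ((2 * R + 5 : ℕ) : ℤ) + 20 ≤ L := by
      apply large_of hl (r := r / 16 - lam) _ L2'.le
      push_cast; nlinarith
    have hTL : 2 * (T * (2 * ((2 * R + 5 : ℕ) : ℤ) + 2)) ≤ L := by
      apply large_of hl (r := r / 16 - lam) _ L2'.le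
      push_cast
      have : lam * T * (8 * R + 24) ≤ c * (8 * R + 24) := by
        apply mul_le_mul_of_nonneg_right T1'; positivity
      nlinarith
    have hT' : lam * ((T * (2 * ((2 * R + 5 : ℕ) : ℤ) + 2) : ℤ) : ℝ) ≤ 1 := by
      push_cast
      have : lam * T * (4 * R + 12) ≤ c * (4 * R + 12) := by
        apply mul_le_mul_of_nonneg_right T1'; positivity
      nlinarith
    have hnorm : 2 * L ≤ |q0.1| ∨ 2 * L ≤ |q0.2| := by
      refine n0'.imp (fun h => ?_) (fun h => ?_)
      · apply large_of hl (r := r / 8) (by push_cast; linarith)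
        rw [abs_mul, abs_of_pos hl] at h
        rw [Int.cast_abs]; exact h
      · apply large_of hl (r := r / 8) (by push_cast; linarith)
        rw [abs_mul, abs_of_pos hl] at h
        rw [Int.cast_abs]; exact h
    have hM' : lam * (8 * (((2 * R + 5 : ℕ) : ℤ) : ℝ) + 20) ≤ 1 := by push_cast; nlinarith
    have hnr := no_return hl hM' (by omega) b0' hLbig hnorm tm_mem hTL hT' (τ + τm) (by omega)
    have hret : (Fe lam ^ (τ + τm)) q0 ∈ Xset lam := by
      rw [← zpow_natCast, hq0, ← Fe_zpow_add]
      have : ((τ + τm : ℕ) : ℤ) + -(τm : ℤ) = τ := by push_cast; ring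
      rw [this]
      exact tp_mem.2
    have hgt : 4 * T < ((τ + τm : ℕ) : ℤ) := by
      by_contra hcon
      exact hnr (by omega) hret
    have hTn : T ≤ ((retOrbit lam p).ncard : ℤ) := by
      by_cases h : 0 ≤ T <;> omega
    have hTn' : (T : ℝ) ≤ ((retOrbit lam p).ncard : ℝ) := by exact_mod_cast hTn
    linarith

lemma Rlam_bd {lam w : ℝ} (hl : 0 < lam) : |lam * ((⌊w / lam⌋ : ℤ) : ℝ) - w| ≤ lam := by
  have h1 := Int.floor_le (w / lam)
  have h2 := Int.sub_one_lt_floor (w / lam)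
  have e : lam * (w / lam) = w := by field_simp
  rw [abs_le]
  constructor <;> nlinarith


/-- For every `w ∈ ℝ²`, `w ≠ 0`, the fraction `μ₂(w,λ)` of points of the return
orbit of `R_λ(w)` at which `v = λ𝐰` tends to `1` as `λ → 0⁺`. -/
theorem mu2_tendsto_one (w : ℝ × ℝ) (hw : w ≠ 0) :
    Tendsto (fun lam => mu2 w lam) (nhdsWithin 0 (Set.Ioi 0)) (nhds 1) := by
  have small : ∀ e : ℝ, 0 < e → ∀ᶠ lam in nhdsWithin (0 : ℝ) (Set.Ioi 0), lam < e := by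
    intro e he
    filter_upwards [Ioo_mem_nhdsGT he] with x hx using hx.2
  obtain ⟨R, hR⟩ := exists_nat_ge (|w.1| + |w.2| + 1)
  have hmpos : 0 < max |w.1| |w.2| := by
    by_contra h
    rw [not_lt, max_le_iff] at h
    apply hw
    ext
    · exact abs_nonpos_iff.1 h.1
    · exact abs_nonpos_iff.1 h.2
  set r : ℝ := min 1 (max |w.1| |w.2| / 2) with hrd
  have hr : 0 < r := by positivity
  have hr1 : r ≤ 1 := min_le_left _ _
  have hrm : 2 * r ≤ max |w.1| |w.2| := by
    have := min_le_right 1 (max |w.1| |w.2| / 2)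
    linarith
  obtain ⟨C, hC⟩ : ∃ C : ℕ, C = 7 + 4 * (3 * ((2 * (2 * R + 2 + 1) + 3) *
    (2 * (4 * R + 10 + (4 * R + 8)) + 1)) + (2 * R + 2 + 2)) := ⟨_, rfl⟩
  set c : ℝ := r / (400 * (R + 3)) with hc
  have hcpos : 0 < c := by positivity
  have lim : Tendsto (fun lam : ℝ => 1 - (4 * C / c) * lam) (nhdsWithin 0 (Set.Ioi 0)) (nhds 1) := by
    have h : Continuous (fun lam : ℝ => 1 - (4 * C / c) * lam) := by fun_prop
    have h2 := h.tendsto 0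
    simp only [mul_zero, sub_zero] at h2
    exact h2.mono_left nhdsWithin_le_nhds
  have bounds : ∀ᶠ lam in nhdsWithin (0 : ℝ) (Set.Ioi 0),
      1 - (4 * C / c) * lam ≤ mu2 w lam ∧ mu2 w lam ≤ 1 := by
    filter_upwards [self_mem_nhdsWithin, small (r / (10000 * (R + 10))) (by positivity),
      small (c / 2) (by positivity)] with lam hl0 hl1 hl2
    have hl : 0 < lam := hl0
    have hlam : lam * (10000 * (R + 10)) ≤ r := by
      rw [lt_div_iff₀ (by positivity)] at hl1; exact hl1.le
    have hR0 : (0 : ℝ) ≤ R := by positivity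
    have hlr : lam ≤ r := by nlinarith
    have d1 := Rlam_bd (w := w.1) hl
    have d2 := Rlam_bd (w := w.2) hl
    have hb : Bd lam R (Rlam lam w) := by
      constructor
      · have := abs_sub_abs_le_abs_sub (lam * ((⌊w.1 / lam⌋ : ℤ) : ℝ)) w.1
        have := abs_nonneg w.2
        simp only [Rlam]
        push_cast
        linarith
      · have := abs_sub_abs_le_abs_sub (lam * ((⌊w.2 / lam⌋ : ℤ) : ℝ)) w.2
        have := abs_nonneg w.1
        simp only [Rlam]
        push_cast
        linarith
    have hn : Nm lam r (Rlam lam w) := by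
      rcases le_max_iff.1 hrm with h | h
      · left
        have := abs_sub_abs_le_abs_sub w.1 (lam * ((⌊w.1 / lam⌋ : ℤ) : ℝ))
        rw [abs_sub_comm w.1] at this
        simp only [Rlam]
        linarith
      · right
        have := abs_sub_abs_le_abs_sub w.2 (lam * ((⌊w.2 / lam⌋ : ℤ) : ℝ))
        rw [abs_sub_comm w.2] at this
        simp only [Rlam]
        linarith
    obtain ⟨hfin, hbad, hcard⟩ := quant hl hr hr1 hlam hb hn hC
    rw [← hc] at hcard
    set O := retOrbit lam (Rlam lam w) with hO
    have hsplit : ({q | q ∈ O ∧ vcond lam q} : Set (ℤ × ℤ)).ncard +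
        ({q | q ∈ O ∧ ¬ vcond lam q} : Set (ℤ × ℤ)).ncard = O.ncard := by
      have := Set.ncard_inter_add_ncard_sdiff_eq_ncard O {q | vcond lam q} hfin
      exact this
    have hsplit' : ((({q | q ∈ O ∧ vcond lam q} : Set (ℤ × ℤ)).ncard : ℕ) : ℝ) +
        ((({q | q ∈ O ∧ ¬ vcond lam q} : Set (ℤ × ℤ)).ncard : ℕ) : ℝ) = (O.ncard : ℝ) := by
      exact_mod_cast hsplit
    have hbad' : ((({q | q ∈ O ∧ ¬ vcond lam q} : Set (ℤ × ℤ)).ncard : ℕ) : ℝ) ≤ 2 * C := by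
      exact_mod_cast hbad
    have hN : c / (2 * lam) ≤ (O.ncard : ℝ) := by
      refine le_trans ?_ hcard
      rw [le_sub_iff_add_le, ← sub_nonneg]
      have : c / lam - (c / (2 * lam) + 1) = (c / 2 - lam) / lam := by field_simp; ring
      rw [this]
      apply div_nonneg <;> linarith
    have hNpos : (0 : ℝ) < (O.ncard : ℝ) := lt_of_lt_of_le (by positivity) hN
    have hmu : mu2 w lam = ((({q | q ∈ O ∧ vcond lam q} : Set (ℤ × ℤ)).ncard : ℕ) : ℝ) / (O.ncard : ℝ) := rfl
    rw [hmu]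
    constructor
    · rw [le_div_iff₀ hNpos]
      have h1 : c ≤ (O.ncard : ℝ) * (2 * lam) := by
        rwa [div_le_iff₀ (by positivity)] at hN
      have h2 : (2 * C : ℝ) ≤ (4 * C / c) * lam * (O.ncard : ℝ) := by
        have e : (4 * C / c) * lam * (O.ncard : ℝ) = 2 * C * (((O.ncard : ℝ) * (2 * lam)) / c) := by
          field_simp; ring
        rw [e]
        have : 1 ≤ ((O.ncard : ℝ) * (2 * lam)) / c := by rw [le_div_iff₀ hcpos]; linarith
        have hC0 : (0 : ℝ) ≤ 2 * C := by positivity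
        nlinarith
      nlinarith
    · rw [div_le_one hNpos]
      have : (0 : ℝ) ≤ ((({q | q ∈ O ∧ ¬ vcond lam q} : Set (ℤ × ℤ)).ncard : ℕ) : ℝ) := by positivity
      linarith
  exact tendsto_of_tendsto_of_tendsto_of_le_of_le' lim tendsto_const_nhds
    (bounds.mono fun _ h => h.1) (bounds.mono fun _ h => h.2)
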